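/- arXiv:0903.5061 — 7 statements merged into one kernel-verified Lean document; each statement's English description precedes it below -/
import Mathlib

section
/- For every t ≥ 0, the integral ∫ (1 − exp(x/2 − t/4))² d(gaussianReal 0 t)(x) over ℝ equals 2·(1 − exp(−t/8)). (This is twice the squared Hellinger distance between a probability measure P and the measure with density exp(x − t/2) with respect to P when x has law N(0,t) under P, as computed in the proof of Lemma 5.4 of the paper.) -/
open MeasureTheory ProbabilityTheory
open scoped NNReal

theorem stmt_0 (t : ℝ≥0) :
    ∫ x : ℝ, (1 - Real.exp (x / 2 - (t : ℝ) / 4)) ^ 2 ∂(gaussianReal 0 t)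
      = 2 * (1 - Real.exp (-(t : ℝ) / 8)) := by
  have hm : ∀ s : ℝ, ∫ x : ℝ, Real.exp (s * x) ∂(gaussianReal 0 t)
      = Real.exp ((t : ℝ) * s ^ 2 / 2) := by
    intro s
    have h := congrFun (mgf_id_gaussianReal (μ := 0) (v := t)) s
    simpa [mgf] using h
  have hi : ∀ s : ℝ, Integrable (fun x : ℝ => Real.exp (s * x)) (gaussianReal 0 t) :=
    fun s => integrable_exp_mul_gaussianReal s
  have he : ∀ x : ℝ, (1 - Real.exp (x / 2 - (t : ℝ) / 4)) ^ 2
      = (1 - 2 * Real.exp (-(t : ℝ) / 4) * Real.exp (1 / 2 * x))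
        + Real.exp (-(t : ℝ) / 2) * Real.exp (1 * x) := by
    intro x
    have h1 : Real.exp (x / 2 - (t : ℝ) / 4)
        = Real.exp (-(t : ℝ) / 4) * Real.exp (1 / 2 * x) := by
      rw [← Real.exp_add]; congr 1; ring
    have h2 : Real.exp (-(t : ℝ) / 2) * Real.exp (1 * x)
        = (Real.exp (-(t : ℝ) / 4) * Real.exp (1 / 2 * x)) ^ 2 := by
      rw [← Real.exp_add, ← Real.exp_add, ← Real.exp_nat_mul]; congr 1; push_cast; ring
    rw [h1, h2]; ring
  simp_rw [he]
  have hs : Integrable (fun x : ℝ => 1 - 2 * Real.exp (-(t : ℝ) / 4) * Real.exp (1 / 2 * x))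
      (gaussianReal 0 t) := (integrable_const _).sub ((hi _).const_mul _)
  rw [integral_add hs ((hi _).const_mul _),
    integral_sub (integrable_const _) ((hi _).const_mul _),
    integral_const_mul, integral_const_mul, hm, hm, mul_assoc, ← Real.exp_add, ← Real.exp_add]
  have e1 : -(t : ℝ) / 4 + (t : ℝ) * (1 / 2) ^ 2 / 2 = -(t : ℝ) / 8 := by ring
  have e2 : -(t : ℝ) / 2 + (t : ℝ) * 1 ^ 2 / 2 = 0 := by ring
  rw [e1, e2]
  simp
  ring
end

section
/- For every t ≥ 0, the integral ∫ (1 − exp(x/2 − t/4))² d(gaussianReal 0 t)(x) over ℝ is at most t/4. (Inequality (5.11) of Lemma 5.4 of the paper, in the reduced Gaussian form with t = J·|u′−u|.) -/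
open MeasureTheory ProbabilityTheory
open scoped NNReal

theorem stmt_1 (t : ℝ≥0) :
    ∫ x : ℝ, (1 - Real.exp (x / 2 - (t : ℝ) / 4)) ^ 2 ∂(gaussianReal 0 t)
      ≤ (t : ℝ) / 4 := by
  have key : ∀ s : ℝ, ∫ x : ℝ, Real.exp (s * x) ∂(gaussianReal 0 t)
      = Real.exp ((t : ℝ) * s ^ 2 / 2) := by
    intro s
    have h := mgf_gaussianReal (p := gaussianReal 0 t) (X := id) (μ := 0) (v := t) (by simp) s
    simpa [mgf] using h
  have i1 : Integrable (fun x : ℝ => Real.exp ((1 / 2) * x)) (gaussianReal 0 t) :=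
    integrable_exp_mul_gaussianReal _
  have i2 : Integrable (fun x : ℝ => Real.exp (1 * x)) (gaussianReal 0 t) :=
    integrable_exp_mul_gaussianReal _
  have e : ∀ x : ℝ, (1 - Real.exp (x / 2 - (t : ℝ) / 4)) ^ 2
      = (1 - 2 * Real.exp (-(t : ℝ) / 4) * Real.exp ((1 / 2) * x))
        + Real.exp (-(t : ℝ) / 2) * Real.exp (1 * x) := by
    intro x
    have h1 : Real.exp (-(t : ℝ) / 2) * Real.exp (1 * x)
        = Real.exp (x / 2 - (t : ℝ) / 4) ^ 2 := by
      rw [← Real.exp_add, ← Real.exp_nat_mul]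
      congr 1
      push_cast
      ring
    have h2 : Real.exp (-(t : ℝ) / 4) * Real.exp ((1 / 2) * x)
        = Real.exp (x / 2 - (t : ℝ) / 4) := by
      rw [← Real.exp_add]
      congr 1
      ring
    rw [h1, mul_assoc, h2]
    ring
  simp_rw [e]
  have i3 : Integrable (fun x : ℝ => 1 - 2 * Real.exp (-(t : ℝ) / 4) * Real.exp ((1 / 2) * x))
      (gaussianReal 0 t) := (integrable_const _).sub (i1.const_mul _)
  rw [integral_add i3 (i2.const_mul _),
    integral_sub (integrable_const _) (i1.const_mul _), integral_const_mul, integral_const_mul,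
    key, key, mul_assoc, ← Real.exp_add, ← Real.exp_add]
  have a1 : -(t : ℝ) / 4 + (t : ℝ) * (1 / 2) ^ 2 / 2 = -(t : ℝ) / 8 := by ring
  have a2 : -(t : ℝ) / 2 + (t : ℝ) * 1 ^ 2 / 2 = 0 := by ring
  rw [a1, a2]
  have := Real.add_one_le_exp (-(t : ℝ) / 8)
  simp only [integral_const, probReal_univ, smul_eq_mul, Real.exp_zero]
  linarith
end

section
/- For every t ≥ 0, the integral ∫ (1 − exp(x/4 − t/8))⁴ d(gaussianReal 0 t)(x) over ℝ equals 2 + 6·exp(−t/8) − 8·exp(−3t/32). (Exact fourth-moment identity computed in the proof of Lemma 5.4 of the paper.) -/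
open MeasureTheory ProbabilityTheory
open scoped NNReal

lemma aux_int (t : ℝ≥0) (k : ℝ) :
    Integrable (fun x : ℝ => Real.exp (k * (x / 4 - (t : ℝ) / 8))) (gaussianReal 0 t) := by
  have h := (integrable_exp_mul_gaussianReal (μ := 0) (v := t) (k / 4)).mul_const
    (Real.exp (-(k * t / 8)))
  refine h.congr (Filter.Eventually.of_forall fun x => ?_)
  simp only [← Real.exp_add]
  congr 1
  ring

lemma aux_val (t : ℝ≥0) (k : ℝ) :
    ∫ x : ℝ, Real.exp (k * (x / 4 - (t : ℝ) / 8)) ∂(gaussianReal 0 t)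
      = Real.exp (k ^ 2 * t / 32 - k * t / 8) := by
  have h := congrFun (mgf_id_gaussianReal (μ := 0) (v := t)) (k / 4)
  simp only [mgf, id] at h
  have e : (fun x : ℝ => Real.exp (k * (x / 4 - (t : ℝ) / 8)))
      = fun x => Real.exp (k / 4 * x) * Real.exp (-(k * t / 8)) := by
    funext x
    rw [← Real.exp_add]
    congr 1
    ring
  rw [e, integral_mul_const, h, ← Real.exp_add]
  congr 1
  ring

theorem stmt_2 (t : ℝ≥0) :
    ∫ x : ℝ, (1 - Real.exp (x / 4 - (t : ℝ) / 8)) ^ 4 ∂(gaussianReal 0 t)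
      = 2 + 6 * Real.exp (-(t : ℝ) / 8) - 8 * Real.exp (-3 * (t : ℝ) / 32) := by
  have e : (fun x : ℝ => (1 - Real.exp (x / 4 - (t : ℝ) / 8)) ^ 4) = fun x =>
      (((Real.exp (0 * (x / 4 - (t : ℝ) / 8)) - 4 * Real.exp (1 * (x / 4 - (t : ℝ) / 8)))
        + 6 * Real.exp (2 * (x / 4 - (t : ℝ) / 8))) - 4 * Real.exp (3 * (x / 4 - (t : ℝ) / 8)))
        + Real.exp (4 * (x / 4 - (t : ℝ) / 8)) := by
    funext x
    generalize x / 4 - (t : ℝ) / 8 = y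
    have h2 : Real.exp (2 * y) = Real.exp y ^ 2 := by exact_mod_cast Real.exp_nat_mul y 2
    have h3 : Real.exp (3 * y) = Real.exp y ^ 3 := by exact_mod_cast Real.exp_nat_mul y 3
    have h4 : Real.exp (4 * y) = Real.exp y ^ 4 := by exact_mod_cast Real.exp_nat_mul y 4
    rw [h2, h3, h4, zero_mul, one_mul, Real.exp_zero]
    ring
  have i0 := aux_int t 0
  have i1 := (aux_int t 1).const_mul 4
  have i2 := (aux_int t 2).const_mul 6
  have i3 := (aux_int t 3).const_mul 4
  have i4 := aux_int t 4
  rw [e, integral_add (by exact ((i0.sub i1).add i2).sub i3) i4,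
    integral_sub (by exact (i0.sub i1).add i2) i3,
    integral_add (by exact i0.sub i1) i2, integral_sub i0 i1]
  simp only [integral_const_mul, aux_val]
  have a0 : (0:ℝ) ^ 2 * t / 32 - 0 * t / 8 = 0 := by ring
  have a1 : (1:ℝ) ^ 2 * t / 32 - 1 * t / 8 = -3 * t / 32 := by ring
  have a2 : (2:ℝ) ^ 2 * t / 32 - 2 * t / 8 = -t / 8 := by ring
  have a3 : (3:ℝ) ^ 2 * t / 32 - 3 * t / 8 = -3 * t / 32 := by ring
  have a4 : (4:ℝ) ^ 2 * t / 32 - 4 * t / 8 = 0 := by ring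
  rw [a0, a1, a2, a3, a4, Real.exp_zero]
  ring
end

section
/- There exists a constant c > 0 such that for every t ≥ 0, the integral ∫ (1 − exp(x/4 − t/8))⁴ d(gaussianReal 0 t)(x) over ℝ is at most c·t². (Inequality (5.12) of Lemma 5.4 of the paper, in the reduced Gaussian form with t = J·|u′−u|; equivalently, 2 + 6·exp(−t/8) − 8·exp(−3t/32) ≤ c·t² for all t ≥ 0.) -/
open MeasureTheory ProbabilityTheory
open scoped NNReal

theorem stmt_3 :
    ∃ c : ℝ, 0 < c ∧ ∀ t : ℝ≥0,
      ∫ x : ℝ, (1 - Real.exp (x / 4 - (t : ℝ) / 8)) ^ 4 ∂(gaussianReal 0 t)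
        ≤ c * (t : ℝ) ^ 2 := by
  refine ⟨1, one_pos, fun t => ?_⟩
  have ht : (0 : ℝ) ≤ t := t.2
  have hint : ∀ a : ℝ, Integrable (fun x : ℝ => Real.exp (a * x)) (gaussianReal 0 t) :=
    fun a => integrable_exp_mul_gaussianReal a
  have hval : ∀ a : ℝ, ∫ x : ℝ, Real.exp (a * x) ∂(gaussianReal 0 t)
      = Real.exp (t * a ^ 2 / 2) := by
    intro a
    have h := congrFun (mgf_id_gaussianReal (μ := 0) (v := t)) a
    simpa [mgf] using h
  have hexp : ∀ x : ℝ, (1 - Real.exp (x / 4 - (t : ℝ) / 8)) ^ 4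
      = 1 + (-4 * Real.exp (-(t : ℝ) / 8)) * Real.exp (1 / 4 * x)
        + (6 * Real.exp (-(t : ℝ) / 8) ^ 2) * Real.exp (1 / 2 * x)
        + (-4 * Real.exp (-(t : ℝ) / 8) ^ 3) * Real.exp (3 / 4 * x)
        + (Real.exp (-(t : ℝ) / 8) ^ 4) * Real.exp (1 * x) := by
    intro x
    have e0 : Real.exp (x / 4 - (t : ℝ) / 8)
        = Real.exp (-(t : ℝ) / 8) * Real.exp (1 / 4 * x) := by
      rw [← Real.exp_add]; congr 1; ring
    have e2 : Real.exp (1 / 2 * x) = Real.exp (1 / 4 * x) ^ 2 := by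
      rw [← Real.exp_nat_mul]; congr 1; push_cast; ring
    have e3 : Real.exp (3 / 4 * x) = Real.exp (1 / 4 * x) ^ 3 := by
      rw [← Real.exp_nat_mul]; congr 1; push_cast; ring
    have e4 : Real.exp (1 * x) = Real.exp (1 / 4 * x) ^ 4 := by
      rw [← Real.exp_nat_mul]; congr 1; push_cast; ring
    rw [e0, e2, e3, e4]; ring
  have i0 : Integrable (fun _ : ℝ => (1 : ℝ)) (gaussianReal 0 t) := integrable_const _
  have i1 := i0.fun_add ((hint (1 / 4)).const_mul (-4 * Real.exp (-(t : ℝ) / 8)))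
  have i2 := i1.fun_add ((hint (1 / 2)).const_mul (6 * Real.exp (-(t : ℝ) / 8) ^ 2))
  have i3 := i2.fun_add ((hint (3 / 4)).const_mul (-4 * Real.exp (-(t : ℝ) / 8) ^ 3))
  simp_rw [hexp]
  rw [integral_add i3 ((hint 1).const_mul _), integral_add i2 ((hint (3 / 4)).const_mul _),
    integral_add i1 ((hint (1 / 2)).const_mul _), integral_add i0 ((hint (1 / 4)).const_mul _)]
  simp only [integral_const_mul, hval]
  have p1 : Real.exp (-(t : ℝ) / 8) * Real.exp (t * (1 / 4) ^ 2 / 2)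
      = Real.exp (-(3 * t / 32)) := by
    rw [← Real.exp_add]; congr 1; ring
  have p2 : Real.exp (-(t : ℝ) / 8) ^ 2 * Real.exp (t * (1 / 2) ^ 2 / 2)
      = Real.exp (-(t / 8)) := by
    rw [← Real.exp_nat_mul, ← Real.exp_add]; congr 1; push_cast; ring
  have p3 : Real.exp (-(t : ℝ) / 8) ^ 3 * Real.exp (t * (3 / 4) ^ 2 / 2)
      = Real.exp (-(3 * t / 32)) := by
    rw [← Real.exp_nat_mul, ← Real.exp_add]; congr 1; push_cast; ring
  have p4 : Real.exp (-(t : ℝ) / 8) ^ 4 * Real.exp (t * 1 ^ 2 / 2) = 1 := by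
    rw [← Real.exp_nat_mul, ← Real.exp_add, Real.exp_eq_one_iff]; push_cast; ring
  have b1 : 1 - 3 * (t : ℝ) / 32 ≤ Real.exp (-(3 * t / 32)) := by
    have := Real.add_one_le_exp (-(3 * (t : ℝ) / 32)); linarith
  have b2 : Real.exp (-((t : ℝ) / 8)) ≤ 1 - t / 8 + (t / 8) ^ 2 / 2 := by
    have hq := Real.quadratic_le_exp_of_nonneg (x := (t : ℝ) / 8) (by positivity)
    have hpos : (0 : ℝ) ≤ 1 - t / 8 + (t / 8) ^ 2 / 2 := by nlinarith [sq_nonneg ((t : ℝ) / 8 - 1)]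
    rw [Real.exp_neg, inv_le_iff_one_le_mul₀ (Real.exp_pos _)]
    have hm := mul_le_mul_of_nonneg_left hq hpos
    have : (0 : ℝ) ≤ (t / 8 : ℝ) ^ 4 := by positivity
    nlinarith
  have c0 : ∫ _ : ℝ, (1 : ℝ) ∂(gaussianReal 0 t) = 1 := by simp
  rw [c0]
  simp only [mul_assoc, p1, p2, p3, p4]
  nlinarith [sq_nonneg (t : ℝ)]
end

section
/- For every t ≥ 0, the integral ∫ |exp(x − t/2) − 1| d(gaussianReal 0 t)(x) over ℝ is at most √t. (Total-variation bound used in step 4 of the proof of Theorem 1.4 of the paper: the L¹-distance between a likelihood ratio exp(x − t/2) and 1 is controlled by the square root of the 'time' parameter t, via Cauchy–Schwarz and the Hellinger computation.) -/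
open MeasureTheory ProbabilityTheory
open scoped NNReal

theorem stmt_5 (t : ℝ≥0) :
    ∫ x : ℝ, |Real.exp (x - (t : ℝ) / 2) - 1| ∂(gaussianReal 0 t)
      ≤ Real.sqrt t := by
  rcases eq_or_ne t 0 with rfl | ht
  · simp [gaussianReal_zero_var]
  have htp : (0 : ℝ) < t := by
    have : 0 < t := pos_iff_ne_zero.mpr ht
    exact_mod_cast this
  obtain ⟨s, hs⟩ : ∃ s, s = Real.sqrt t := ⟨_, rfl⟩
  have hs0 : 0 < s := hs ▸ Real.sqrt_pos.mpr htp
  have hss : s ^ 2 = t := by rw [hs]; exact Real.sq_sqrt htp.le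
  rw [← hs]
  have hmgf : ∀ a : ℝ, ∫ x, Real.exp (a * x) ∂(gaussianReal 0 t)
      = Real.exp (t * a ^ 2 / 2) := by
    intro a
    have h := congrFun (mgf_id_gaussianReal (μ := 0) (v := t)) a
    simpa [mgf] using h
  obtain ⟨ρ, hρ⟩ : ∃ ρ, ρ = Real.exp (-(t : ℝ) / 8) := ⟨_, rfl⟩
  have hρ0 : 0 < ρ := hρ ▸ Real.exp_pos _
  have hρ2 : 1 - ρ ^ 2 ≤ t / 4 := by
    have h1 : ρ ^ 2 = Real.exp (-(t : ℝ) / 4) := by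
      rw [hρ, ← Real.exp_nat_mul]; congr 1; push_cast; ring
    have h2 := Real.add_one_le_exp (-(t : ℝ) / 4)
    linarith
  have e1 : ∀ x : ℝ, Real.exp (x - t / 2) = Real.exp (-(t : ℝ) / 2) * Real.exp (1 * x) := by
    intro x; rw [← Real.exp_add]; congr 1; ring
  have e2 : ∀ x : ℝ, Real.exp ((x - t / 2) / 2)
      = Real.exp (-(t : ℝ) / 4) * Real.exp ((1 / 2) * x) := by
    intro x; rw [← Real.exp_add]; congr 1; ring
  have i1 : Integrable (fun x : ℝ => Real.exp (x - t / 2)) (gaussianReal 0 t) := by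
    simp_rw [e1]; exact (integrable_exp_mul_gaussianReal 1).const_mul _
  have i2 : Integrable (fun x : ℝ => Real.exp ((x - t / 2) / 2)) (gaussianReal 0 t) := by
    simp_rw [e2]; exact (integrable_exp_mul_gaussianReal (1 / 2)).const_mul _
  have I1 : ∫ x : ℝ, Real.exp (x - t / 2) ∂(gaussianReal 0 t) = 1 := by
    simp_rw [e1]
    rw [integral_const_mul, hmgf, ← Real.exp_add, Real.exp_eq_one_iff]; ring
  have I2 : ∫ x : ℝ, Real.exp ((x - t / 2) / 2) ∂(gaussianReal 0 t) = ρ := by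
    simp_rw [e2]
    rw [integral_const_mul, hmgf, ← Real.exp_add, hρ]; congr 1; ring
  obtain ⟨a, ha⟩ : ∃ a, a = (1 + ρ) / s := ⟨_, rfl⟩
  obtain ⟨b, hb⟩ : ∃ b, b = s / (4 * (1 + ρ)) := ⟨_, rfl⟩
  have ha0 : 0 < a := by rw [ha]; positivity
  have hb0 : 0 < b := by rw [hb]; positivity
  have hab : 4 * (a * b) = 1 := by rw [ha, hb]; field_simp
  have key : ∀ x : ℝ, |Real.exp (x - (t : ℝ) / 2) - 1|
      ≤ (a + b) * Real.exp (x - t / 2) + (2 * b - 2 * a) * Real.exp ((x - t / 2) / 2)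
        + (a + b) := by
    intro x
    have hu : Real.exp (x - t / 2) = Real.exp ((x - t / 2) / 2) ^ 2 := by
      rw [← Real.exp_nat_mul]; congr 1; push_cast; ring
    rw [hu]
    generalize Real.exp ((x - t / 2) / 2) = u
    have hR : (a + b) * u ^ 2 + (2 * b - 2 * a) * u + (a + b)
        = a * (u - 1) ^ 2 + b * (u + 1) ^ 2 := by ring
    rw [hR]
    refine abs_le_of_sq_le_sq ?_ (by positivity)
    have : (a * (u - 1) ^ 2 + b * (u + 1) ^ 2) ^ 2 - (u ^ 2 - 1) ^ 2
        = (a * (u - 1) ^ 2 - b * (u + 1) ^ 2) ^ 2 := by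
      linear_combination (u ^ 2 - 1) ^ 2 * hab
    nlinarith [sq_nonneg (a * (u - 1) ^ 2 - b * (u + 1) ^ 2)]
  have iA := i1.const_mul (a + b)
  have iB := i2.const_mul (2 * b - 2 * a)
  calc _ ≤ ∫ x : ℝ, ((a + b) * Real.exp (x - t / 2)
        + (2 * b - 2 * a) * Real.exp ((x - t / 2) / 2) + (a + b)) ∂(gaussianReal 0 t) :=
        integral_mono (i1.sub (integrable_const 1)).abs
          ((iA.add iB).add (integrable_const _)) key
    _ = (a + b) + (2 * b - 2 * a) * ρ + (a + b) := by
        have iAB : Integrable (fun x : ℝ => (a + b) * Real.exp (x - t / 2)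
            + (2 * b - 2 * a) * Real.exp ((x - t / 2) / 2)) (gaussianReal 0 t) := iA.add iB
        rw [integral_add iAB (integrable_const _), integral_add iA iB,
          integral_const_mul, integral_const_mul, I1, I2]
        simp
    _ = 2 * (1 - ρ ^ 2) / s + s / 2 := by rw [ha, hb]; field_simp; ring
    _ ≤ s := by
        have : 2 * (1 - ρ ^ 2) / s ≤ s / 2 := by
          rw [div_le_iff₀ hs0]; nlinarith
        linarith
end

section
/- Let T > 0, γ > 0, σ > 0, and let S : ℝ → ℝ be measurable, bounded and T-periodic. Set c := ∫₀ᵀ e^{−γv} S(T−v) dv, m := (1 − e^{−γT})^{−1} · ∫₀ᵀ e^{−γv} S(−v) dv, and define the Markov kernel κ on ℝ by κ(x) := gaussianReal (x·e^{−γT} + c) (σ²·(1 − e^{−2γT})/(2γ)). Then the Gaussian probability measure μ := gaussianReal m (σ²/(2γ)) is invariant for κ, i.e. the measure μ.bind κ (the distribution obtained by sampling x from μ and then sampling from κ(x)) equals μ. (Invariance of the measure μ for the time-T transition kernel of the Ornstein–Uhlenbeck diffusion with T-periodic input, Example 2.3 of the paper.) -/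
open MeasureTheory ProbabilityTheory
open scoped NNReal

theorem stmt_8 (T γ σ : ℝ) (hT : 0 < T) (hγ : 0 < γ) (hσ : 0 < σ)
    (S : ℝ → ℝ) (hSm : Measurable S) (hSb : ∃ C : ℝ, ∀ s, |S s| ≤ C)
    (hSp : ∀ s : ℝ, S (s + T) = S s)
    (c m : ℝ)
    (hc : c = ∫ v in (0 : ℝ)..T, Real.exp (-γ * v) * S (T - v))
    (hm : m = (1 - Real.exp (-γ * T))⁻¹ * ∫ v in (0 : ℝ)..T, Real.exp (-γ * v) * S (-v))
    (κ : ℝ → Measure ℝ)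
    (hκ : ∀ x : ℝ, κ x = gaussianReal (x * Real.exp (-γ * T) + c)
        ((σ ^ 2 * (1 - Real.exp (-2 * γ * T)) / (2 * γ)).toNNReal)) :
    (gaussianReal m ((σ ^ 2 / (2 * γ)).toNNReal)).bind κ
      = gaussianReal m ((σ ^ 2 / (2 * γ)).toNNReal) := by
  have hexp : Real.exp (-γ * T) < 1 := by
    rw [Real.exp_lt_one_iff]; nlinarith [mul_pos hγ hT]
  have hsq : Real.exp (-2 * γ * T) = Real.exp (-γ * T) ^ 2 := by
    rw [← Real.exp_nat_mul]; congr 1; push_cast; ring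
  have hpos := Real.exp_pos (-γ * T)
  have hcm : c = (1 - Real.exp (-γ * T)) * m := by
    have h0 : 1 - Real.exp (-γ * T) ≠ 0 := by linarith
    rw [hm, ← mul_assoc, mul_inv_cancel₀ h0, one_mul, hc]
    congr 1
    ext v
    rw [← hSp (-v)]
    congr 2
    ring
  set e := Real.exp (-γ * T) with he
  rw [hsq] at hκ
  set v : ℝ≥0 := (σ ^ 2 * (1 - e ^ 2) / (2 * γ)).toNNReal with hv
  set w : ℝ≥0 := (σ ^ 2 / (2 * γ)).toNNReal with hw
  have hκm : Measurable κ := by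
    have : κ = fun x => gaussianReal (x * e + c) v := funext hκ
    rw [this]
    exact measurable_gaussianReal.comp
      (f := fun x : ℝ => (x * e + c, v)) (by fun_prop)
  have key : (gaussianReal m w).bind κ
      = ((gaussianReal m w).map (· * e)).conv (gaussianReal c v) := by
    ext B hB
    rw [Measure.bind_apply hB hκm.aemeasurable, ← lintegral_indicator_one hB,
      Measure.lintegral_conv (measurable_one.indicator hB), lintegral_map]
    · refine lintegral_congr fun x => ?_
      have h1 : κ x = (gaussianReal c v).map (x * e + ·) := by
        rw [hκ, gaussianReal_map_const_add, add_comm]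
      rw [h1, ← lintegral_indicator_one hB, lintegral_map (measurable_one.indicator hB)
        (by fun_prop)]
    · exact Measurable.lintegral_prod_right'
        (f := fun p : ℝ × ℝ => B.indicator (1 : ℝ → ENNReal) (p.1 + p.2))
        ((measurable_one.indicator hB).comp (measurable_fst.add measurable_snd))
    · fun_prop
  rw [key, gaussianReal_map_mul_const, gaussianReal_conv_gaussianReal]
  congr 1
  · rw [hcm]; ring
  · have he2 : 0 ≤ 1 - e ^ 2 := by nlinarith
    apply NNReal.eq
    rw [NNReal.coe_add, NNReal.coe_mul, hv, hw, Real.coe_toNNReal _ (by positivity),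
      Real.coe_toNNReal _ (by positivity)]
    simp only [NNReal.coe_mk]
    field_simp
    ring
end

section
/- Let T > 0, γ > 0, σ > 0, x ∈ ℝ, and let S : ℝ → ℝ be measurable, bounded and T-periodic. Set m := (1 − e^{−γT})^{−1} · ∫₀ᵀ e^{−γv} S(−v) dv. Then the sequence of Gaussian probability measures ν_k := gaussianReal (x·e^{−γkT} + ∫₀^{kT} e^{−γv} S(kT−v) dv) (σ²·(1 − e^{−2γkT})/(2γ)) converges weakly, as k → ∞, to the Gaussian probability measure gaussianReal m (σ²/(2γ)). (Convergence (2.16) of Example 2.3 of the paper: P_{0,kT}(x,·) → μ weakly for every starting point x.) -/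
open MeasureTheory ProbabilityTheory
open scoped NNReal

theorem stmt_9 (T γ σ x : ℝ) (hT : 0 < T) (hγ : 0 < γ) (hσ : 0 < σ)
    (S : ℝ → ℝ) (hSm : Measurable S) (hSb : ∃ C : ℝ, ∀ s, |S s| ≤ C)
    (hSp : ∀ s : ℝ, S (s + T) = S s)
    (m : ℝ)
    (hm : m = (1 - Real.exp (-γ * T))⁻¹ * ∫ v in (0 : ℝ)..T, Real.exp (-γ * v) * S (-v))
    (ν : ℕ → Measure ℝ)
    (hν : ∀ k : ℕ, ν k = gaussianReal
        (x * Real.exp (-γ * (k * T))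
          + ∫ v in (0 : ℝ)..((k : ℝ) * T), Real.exp (-γ * v) * S ((k : ℝ) * T - v))
        ((σ ^ 2 * (1 - Real.exp (-2 * γ * ((k : ℝ) * T))) / (2 * γ)).toNNReal)) :
    ∀ f : ℝ → ℝ, Continuous f → (∃ C : ℝ, ∀ y, |f y| ≤ C) →
      Filter.Tendsto (fun k : ℕ => ∫ y, f y ∂(ν k)) Filter.atTop
        (nhds (∫ y, f y ∂(gaussianReal m ((σ ^ 2 / (2 * γ)).toNNReal)))) := by
  intro f hf hfb
  obtain ⟨C, hC⟩ := hSb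
  obtain ⟨B, hB⟩ := hfb
  have hper : Function.Periodic S T := hSp
  set q := Real.exp (-γ * T) with hq
  have hq0 : 0 < q := Real.exp_pos _
  have hq1 : q < 1 := by
    rw [hq, Real.exp_lt_one_iff]
    nlinarith [mul_pos hγ hT]
  set g : ℝ → ℝ := fun v => Real.exp (-γ * v) * S (-v) with hg
  have hint : ∀ a b : ℝ, IntervalIntegrable g volume a b := by
    intro a b
    have h1 : IntervalIntegrable (fun v => S (-v)) volume a b := by
      refine (intervalIntegrable_const (c := C)).mono_fun
        (hSm.comp measurable_neg).aestronglyMeasurable ?_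
      refine Filter.Eventually.of_forall fun v => ?_
      simpa using (hC (-v)).trans (le_abs_self C)
    exact h1.continuousOn_mul (by fun_prop)
  have hqk : ∀ k : ℕ, Real.exp (-γ * (k * T)) = q ^ k := by
    intro k
    rw [hq, ← Real.exp_nat_mul]
    congr 1; ring
  have hm' : (∫ v in (0 : ℝ)..T, g v) = (1 - q) * m := by
    rw [hm, ← mul_assoc, mul_inv_cancel₀ (by linarith), one_mul]
  have hJ : ∀ k : ℕ, (∫ v in (0 : ℝ)..((k : ℝ) * T), g v) = (1 - q ^ k) * m := by
    intro k
    induction k with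
    | zero => simp
    | succ k ih =>
      rw [← intervalIntegral.integral_add_adjacent_intervals (hint 0 T) (hint T _), hm']
      have h2 : (∫ v in T..(((k + 1 : ℕ) : ℝ) * T), g v) = q * ∫ v in (0 : ℝ)..((k : ℝ) * T), g v := by
        rw [← intervalIntegral.integral_const_mul]
        have h3 := intervalIntegral.integral_comp_add_right (a := 0) (b := (k : ℝ) * T) g T
        rw [show ((k + 1 : ℕ) : ℝ) * T = (k : ℝ) * T + T by push_cast; ring]
        rw [zero_add] at h3
        rw [← h3]
        congr 1
        funext v
        simp only [hg, hq]
        rw [← mul_assoc, ← Real.exp_add, ← hSp (-(v + T))]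
        congr 2 <;> ring
      rw [h2, ih]
      ring
  have hmean : ∀ k : ℕ, x * Real.exp (-γ * (k * T))
          + ∫ v in (0 : ℝ)..((k : ℝ) * T), Real.exp (-γ * v) * S ((k : ℝ) * T - v)
        = x * q ^ k + (1 - q ^ k) * m := by
    intro k
    rw [hqk, ← hJ k]
    congr 2
    funext v
    simp only [hg]
    congr 1
    have := hper.nat_mul k (-v)
    rw [← this]
    congr 1; ring
  have hpow : Filter.Tendsto (fun k : ℕ => q ^ k) Filter.atTop (nhds 0) :=
    tendsto_pow_atTop_nhds_zero_of_lt_one hq0.le hq1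
  have hmt : Filter.Tendsto (fun k : ℕ => x * q ^ k + (1 - q ^ k) * m) Filter.atTop (nhds m) := by
    have := (hpow.const_mul x).add ((hpow.const_sub 1).mul_const m)
    simpa using this
  have hvt : Filter.Tendsto
      (fun k : ℕ => (σ ^ 2 * (1 - Real.exp (-2 * γ * ((k : ℝ) * T))) / (2 * γ)).toNNReal)
      Filter.atTop (nhds ((σ ^ 2 / (2 * γ)).toNNReal)) := by
    refine (continuous_real_toNNReal.tendsto _).comp ?_
    have h4 : ∀ k : ℕ, Real.exp (-2 * γ * ((k : ℝ) * T)) = q ^ k * q ^ k := by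
      intro k
      rw [← hqk, ← Real.exp_add]
      congr 1; ring
    simp only [h4]
    have := (((hpow.mul hpow).const_sub 1).const_mul (σ ^ 2)).div_const (2 * γ)
    simpa using this
  let P : ℕ → ProbabilityMeasure ℝ := fun k => ⟨ν k, by rw [hν]; infer_instance⟩
  let Q : ProbabilityMeasure ℝ := ⟨gaussianReal m ((σ ^ 2 / (2 * γ)).toNNReal), inferInstance⟩
  have hPQ : Filter.Tendsto P Filter.atTop (nhds Q) := by
    refine ProbabilityMeasure.tendsto_iff_tendsto_charFun.2 fun t => ?_
    simp only [P, Q, ProbabilityMeasure.coe_mk, hν, hmean, charFun_gaussianReal]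
    refine (Complex.continuous_exp.tendsto _).comp ?_
    have a1 := (Complex.continuous_ofReal.tendsto _).comp hmt
    have a2 := ((Complex.continuous_ofReal.comp NNReal.continuous_coe).tendsto _).comp hvt
    exact ((a1.const_mul (t : ℂ)).mul_const Complex.I).sub
      ((a2.mul_const ((t : ℂ) ^ 2)).div_const 2)
  have := ProbabilityMeasure.tendsto_iff_forall_integral_tendsto.1 hPQ
    (BoundedContinuousFunction.ofNormedAddCommGroup f hf B hB)
  exact this
end
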